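/- Every triple system on a 5-element vertex set with at least 6 triples contains a Berge-K4. -/

import Mathlib

/-- `HasBergeK4 H` : `H` contains a Berge-`K₄`, i.e. four distinct vertices
`v₁, v₂, v₃, v₄` and six pairwise distinct triples `e_{ij} ∈ H` with
`{vᵢ, vⱼ} ⊆ e_{ij}` for every `1 ≤ i < j ≤ 4`. -/
def HasBergeK4 {V : Type*} [DecidableEq V] (H : Finset (Finset V)) : Prop :=
  ∃ v₁ v₂ v₃ v₄ : V, ∃ e₁₂ e₁₃ e₁₄ e₂₃ e₂₄ e₃₄ : Finset V,
    v₁ ≠ v₂ ∧ v₁ ≠ v₃ ∧ v₁ ≠ v₄ ∧ v₂ ≠ v₃ ∧ v₂ ≠ v₄ ∧ v₃ ≠ v₄ ∧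
    ([e₁₂, e₁₃, e₁₄, e₂₃, e₂₄, e₃₄] : List (Finset V)).Nodup ∧
    e₁₂ ∈ H ∧ e₁₃ ∈ H ∧ e₁₄ ∈ H ∧ e₂₃ ∈ H ∧ e₂₄ ∈ H ∧ e₃₄ ∈ H ∧
    {v₁, v₂} ⊆ e₁₂ ∧ {v₁, v₃} ⊆ e₁₃ ∧ {v₁, v₄} ⊆ e₁₄ ∧
    {v₂, v₃} ⊆ e₂₃ ∧ {v₂, v₄} ⊆ e₂₄ ∧ {v₃, v₄} ⊆ e₃₄

/-- Backtracking search for pairwise distinct members of the second list, one for each member of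
the first list and related to it by `r`. -/
def hasDistinctReps {α β : Type*} [DecidableEq β] (r : α → β → Bool) : List α → List β → Bool
  | [], _ => true
  | a :: l, L => L.any fun b => r a b && hasDistinctReps r l (L.erase b)

theorem exists_nodup_of_hasDistinctReps {α β : Type*} [DecidableEq β] {r : α → β → Bool}
    {l : List α} {L : List β} (hL : L.Nodup) (h : hasDistinctReps r l L = true) :
    ∃ R : List β, R.Nodup ∧ R ⊆ L ∧ List.Forall₂ (fun a b => r a b = true) l R := by
  induction l generalizing L with
  | nil => exact ⟨[], by simp⟩
  | cons a l ih =>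
    simp only [hasDistinctReps, List.any_eq_true, Bool.and_eq_true] at h
    obtain ⟨b, hb, hab, h⟩ := h
    obtain ⟨R, hR, hRL, hr⟩ := ih (hL.erase b) h
    refine ⟨b :: R, List.nodup_cons.2 ⟨fun hbR => ?_, hR⟩, ?_, .cons hab hr⟩
    · exact hL.not_mem_erase (hRL hbR)
    · exact List.cons_subset.2 ⟨hb, fun x hx => List.mem_of_mem_erase (hRL hx)⟩

/-- The binary codes of the triples in `Fin 5`. -/
def tripleCodes : List ℕ := [7, 11, 13, 14, 19, 21, 22, 25, 26, 28]

/-- The subset of `Fin 5` with binary code `c`. -/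
def decodeSet (c : ℕ) : Finset (Fin 5) := Finset.univ.filter fun v => c.testBit v

theorem mem_decodeSet {c : ℕ} {v : Fin 5} : v ∈ decodeSet c ↔ c.testBit v = true := by
  simp [decodeSet]

theorem decodeSet_injOn : ∀ c ∈ tripleCodes, ∀ d ∈ tripleCodes,
    decodeSet c = decodeSet d → c = d := by
  decide +kernel

theorem exists_decodeSet_eq : ∀ t : Finset (Fin 5), t.card = 3 →
    ∃ c ∈ tripleCodes, decodeSet c = t := by
  decide +kernel

/-- The six pairs from four vertices. -/
def sixPairs {V : Type*} (v : V × V × V × V) : List (V × V) :=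
  [(v.1, v.2.1), (v.1, v.2.2.1), (v.1, v.2.2.2), (v.2.1, v.2.2.1), (v.2.1, v.2.2.2),
    (v.2.2.1, v.2.2.2)]

/-- The five 4-element subsets of `Fin 5`, as increasing tuples. -/
def quadruples : List (Fin 5 × Fin 5 × Fin 5 × Fin 5) :=
  [(0, 1, 2, 3), (0, 1, 2, 4), (0, 1, 3, 4), (0, 2, 3, 4), (1, 2, 3, 4)]

theorem exists_hasDistinctReps_of_mem_sublistsLen :
    ∀ L ∈ tripleCodes.sublistsLen 6, ∃ v ∈ quadruples,
      hasDistinctReps (fun (p : Fin 5 × Fin 5) c => c.testBit p.1 && c.testBit p.2)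
        (sixPairs v) L = true := by
  decide +kernel

theorem ne_of_mem_quadruples : ∀ v ∈ quadruples,
    v.1 ≠ v.2.1 ∧ v.1 ≠ v.2.2.1 ∧ v.1 ≠ v.2.2.2 ∧ v.2.1 ≠ v.2.2.1 ∧ v.2.1 ≠ v.2.2.2 ∧
      v.2.2.1 ≠ v.2.2.2 := by
  simp [quadruples]

theorem hasBergeK4_of_mem_powersetCard_fin_five {H : Finset (Finset (Fin 5))}
    (hH : H ∈ Finset.powersetCard 6 (Finset.powersetCard 3 Finset.univ)) : HasBergeK4 H := by
  obtain ⟨hH3, hcard⟩ := Finset.mem_powersetCard.1 hH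
  have hnodup : tripleCodes.Nodup := by decide
  let L := tripleCodes.filter fun c => decodeSet c ∈ H
  have hL : L.Nodup := hnodup.filter _
  have hmem {c : ℕ} : c ∈ L ↔ c ∈ tripleCodes ∧ decodeSet c ∈ H := by simp [L]
  have hinj {c d : ℕ} (hc : c ∈ L) (hd : d ∈ L) (h : decodeSet c = decodeSet d) : c = d :=
    decodeSet_injOn c (hmem.1 hc).1 d (hmem.1 hd).1 h
  have himage : L.toFinset.image decodeSet = H := by
    ext t
    simp only [Finset.mem_image, List.mem_toFinset, hmem]
    constructor
    · rintro ⟨c, ⟨-, hc⟩, rfl⟩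
      exact hc
    · intro ht
      obtain ⟨c, hc, rfl⟩ := exists_decodeSet_eq t (Finset.mem_powersetCard.1 (hH3 ht)).2
      exact ⟨c, ⟨hc, ht⟩, rfl⟩
  have hlen : L.length = 6 := by
    rw [← hcard, ← himage, Finset.card_image_of_injOn, List.toFinset_card_of_nodup hL]
    intro c hc d hd h
    exact hinj (by simpa using hc) (by simpa using hd) h
  obtain ⟨v, hv, hreps⟩ := exists_hasDistinctReps_of_mem_sublistsLen L
    (List.mem_sublistsLen.2 ⟨List.filter_sublist, hlen⟩)
  obtain ⟨R, hR, hRL, hr⟩ := exists_nodup_of_hasDistinctReps hL hreps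
  have hR' : (R.map decodeSet).Nodup :=
    hR.map_on fun c hc d hd h => hinj (hRL hc) (hRL hd) h
  have hRH {c : ℕ} (hc : c ∈ R) : decodeSet c ∈ H := (hmem.1 (hRL hc)).2
  simp only [sixPairs, List.forall₂_cons_left_iff, List.forall₂_nil_left_iff, Bool.and_eq_true,
    ← mem_decodeSet] at hr
  obtain ⟨a, _, ha, ⟨b, _, hb, ⟨c, _, hc, ⟨d, _, hd, ⟨e, _, he, ⟨f, _, hf, rfl, rfl⟩,
    rfl⟩, rfl⟩, rfl⟩, rfl⟩, rfl⟩ := hr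
  obtain ⟨h₁₂, h₁₃, h₁₄, h₂₃, h₂₄, h₃₄⟩ := ne_of_mem_quadruples v hv
  refine ⟨v.1, v.2.1, v.2.2.1, v.2.2.2, decodeSet a, decodeSet b, decodeSet c, decodeSet d,
    decodeSet e, decodeSet f, h₁₂, h₁₃, h₁₄, h₂₃, h₂₄, h₃₄, hR', hRH (by simp), hRH (by simp),
    hRH (by simp), hRH (by simp), hRH (by simp), hRH (by simp), ?_⟩
  simp only [Finset.insert_subset_iff, Finset.singleton_subset_iff]
  exact ⟨ha, hb, hc, hd, he, hf⟩

theorem HasBergeK4.mono {V : Type*} [DecidableEq V] {H K : Finset (Finset V)} (hHK : H ⊆ K)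
    (h : HasBergeK4 H) : HasBergeK4 K := by
  obtain ⟨v₁, v₂, v₃, v₄, a, b, c, d, e, f, h₁₂, h₁₃, h₁₄, h₂₃, h₂₄, h₃₄, hn,
    ha, hb, hc, hd, he, hf, hs⟩ := h
  exact ⟨v₁, v₂, v₃, v₄, a, b, c, d, e, f, h₁₂, h₁₃, h₁₄, h₂₃, h₂₄, h₃₄, hn,
    hHK ha, hHK hb, hHK hc, hHK hd, hHK he, hHK hf, hs⟩

theorem HasBergeK4.map {V W : Type*} [DecidableEq V] [DecidableEq W] (φ : V ↪ W)
    {H : Finset (Finset V)} (h : HasBergeK4 H) :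
    HasBergeK4 (H.map (Finset.mapEmbedding φ).toEmbedding) := by
  obtain ⟨v₁, v₂, v₃, v₄, a, b, c, d, e, f, h₁₂, h₁₃, h₁₄, h₂₃, h₂₄, h₃₄, hn,
    ha, hb, hc, hd, he, hf, hs⟩ := h
  refine ⟨φ v₁, φ v₂, φ v₃, φ v₄, a.map φ, b.map φ, c.map φ, d.map φ, e.map φ, f.map φ, ?_⟩
  simp only [Finset.insert_subset_iff, Finset.singleton_subset_iff] at hs ⊢
  simp_all

/-- Every triple system on a 5-element vertex set with at
least `6` triples contains a Berge-`K₄`. -/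
theorem bergeK4_of_six_triples_on_five
    (V : Type*) [DecidableEq V] [Fintype V] (hV : Fintype.card V = 5)
    (H : Finset (Finset V)) (hH3 : ∀ t ∈ H, t.card = 3)
    (hcard : 6 ≤ H.card) :
    HasBergeK4 H := by
  obtain ⟨K, hKH, hK⟩ := Finset.exists_subset_card_eq hcard
  let φ : V ≃ Fin 5 := Fintype.equivFinOfCardEq hV
  have hmem : K.map (Finset.mapEmbedding φ.toEmbedding).toEmbedding ∈
      Finset.powersetCard 6 (Finset.powersetCard 3 Finset.univ) := by
    rw [Finset.mem_powersetCard, Finset.card_map]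
    refine ⟨fun t ht => ?_, hK⟩
    obtain ⟨s, hs, rfl⟩ := Finset.mem_map.1 ht
    simpa using hH3 s (hKH hs)
  refine ((hasBergeK4_of_mem_powersetCard_fin_five hmem).map φ.symm.toEmbedding).mono ?_
  intro t ht
  simp only [Finset.mem_map] at ht
  obtain ⟨_, ⟨s, hs, rfl⟩, rfl⟩ := ht
  simpa [Finset.map_map] using hKH hs
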